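/- arXiv:1811.05503 — 2 statements merged into one kernel-verified Lean document; each statement's English description precedes it below -/
import Mathlib

section
/- Let τ > 0 and let α : ℝ → ℝ be continuous and τ-periodic with ∫_0^τ α(u) du > 0. Let ω : ℝ → ℝ be continuous with |ω(r)| ≤ C(1 + |r|) for all r ∈ ℝ, for some constant C ≥ 0. Define e(r,s) := exp(−∫_r^s α(u) du) and S(s, ω) := ω(s) − ∫_{−∞}^{s} α(r) e(r,s) ω(r) dr (the improper integral converges absolutely under these hypotheses). Define the shift θ_τ ω := (u ↦ ω(u+τ) − ω(τ)). Then for every s ∈ ℝ, S(s+τ, ω) = S(s, θ_τ ω). -/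
open MeasureTheory

/-- `e(r,s) = exp(-∫_r^s α(u) du)`. -/
noncomputable def expFactor (α : ℝ → ℝ) (r s : ℝ) : ℝ :=
  Real.exp (-(∫ u in r..s, α u))

/-- The pathwise random periodic solution
`S(s,ω) = ω(s) - ∫_{-∞}^s α(r) e(r,s) ω(r) dr`. -/
noncomputable def pathwiseRPS (α : ℝ → ℝ) (s : ℝ) (ω : ℝ → ℝ) : ℝ :=
  ω s - ∫ r in Set.Iic s, α r * expFactor α r s * ω r

/-- The exponential weight is invariant under a simultaneous shift by a period of `α`. -/
theorem expFactor_add_period {τ : ℝ} {α : ℝ → ℝ} (hper : Function.Periodic α τ) (r s : ℝ) :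
    expFactor α (r + τ) (s + τ) = expFactor α r s := by
  unfold expFactor
  rw [← intervalIntegral.integral_comp_add_right]
  simp only [hper _]

theorem hasDerivAt_expFactor {α : ℝ → ℝ} (hα : Continuous α) (r s : ℝ) :
    HasDerivAt (fun r => expFactor α r s) (α r * expFactor α r s) r := by
  have h := (intervalIntegral.integral_hasDerivAt_left (hα.intervalIntegrable r s)
    (hα.stronglyMeasurableAtFilter _ _) hα.continuousAt).neg.exp
  simpa [expFactor, mul_comm] using h

theorem expFactor_pos (α : ℝ → ℝ) (r s : ℝ) : 0 < expFactor α r s := Real.exp_pos _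

/-- A periodic rate with positive mean gives an exponentially decaying weight at `-∞`. -/
theorem exists_expFactor_le {τ : ℝ} (hτ : 0 < τ) {α : ℝ → ℝ} (hα : Continuous α)
    (hper : Function.Periodic α τ) (hmean : 0 < ∫ u in (0 : ℝ)..τ, α u) (s : ℝ) :
    ∃ c > 0, ∃ K > 0, ∀ r, expFactor α r s ≤ K * Real.exp (c * r) := by
  set m := ∫ u in (0 : ℝ)..τ, α u
  set B := sSup ((fun t => ∫ x in (0 : ℝ)..t, α x) '' Set.Icc 0 τ)
  refine ⟨m / τ, div_pos hmean hτ, Real.exp (B - ∫ u in (0 : ℝ)..s, α u), Real.exp_pos _,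
    fun r => ?_⟩
  have hB := hper.integral_le_sSup_add_zsmul_of_pos (hα.intervalIntegrable 0 τ) hτ r
  have hsplit := intervalIntegral.integral_interval_sub_left
    (hα.intervalIntegrable (μ := volume) 0 s) (hα.intervalIntegrable 0 r)
  have hfloor : ⌊r / τ⌋ • m ≤ m / τ * r := by
    rw [zsmul_eq_mul]
    calc (⌊r / τ⌋ : ℝ) * m ≤ r / τ * m := by gcongr; exact Int.floor_le _
      _ = m / τ * r := by ring
  rw [expFactor, ← Real.exp_add, Real.exp_le_exp]
  linarith

theorem tendsto_expFactor_atBot {τ : ℝ} (hτ : 0 < τ) {α : ℝ → ℝ} (hα : Continuous α)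
    (hper : Function.Periodic α τ) (hmean : 0 < ∫ u in (0 : ℝ)..τ, α u) (s : ℝ) :
    Filter.Tendsto (fun r => expFactor α r s) Filter.atBot (nhds 0) := by
  obtain ⟨c, hc, K, -, hle⟩ := exists_expFactor_le hτ hα hper hmean s
  refine squeeze_zero (fun r => (expFactor_pos α r s).le) hle ?_
  simpa using (Real.tendsto_exp_atBot.comp
    (Filter.tendsto_id.const_mul_atBot hc)).const_mul K

/-- The integrand of the pathwise solution is integrable for paths of at most linear growth. -/
theorem integrableOn_mul_expFactor_mul {τ : ℝ} (hτ : 0 < τ) {α : ℝ → ℝ} (hα : Continuous α)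
    (hper : Function.Periodic α τ) (hmean : 0 < ∫ u in (0 : ℝ)..τ, α u)
    {ω : ℝ → ℝ} (hω : Continuous ω) {C : ℝ} (hgrow : ∀ r, |ω r| ≤ C * (1 + |r|)) (s : ℝ) :
    IntegrableOn (fun r => α r * expFactor α r s * ω r) (Set.Iic s) := by
  obtain ⟨c, hc, K, hK, hle⟩ := exists_expFactor_le hτ hα hper hmean s
  obtain ⟨M, hM⟩ := (hper.isBounded_of_continuous hτ.ne' hα).exists_norm_le
  have hM' : ∀ r, |α r| ≤ M := fun r => hM _ (Set.mem_range_self r)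
  have hM0 : 0 ≤ M := (abs_nonneg _).trans (hM' 0)
  have hC : 0 ≤ C := by simpa using (abs_nonneg _).trans (hgrow 0)
  have hcont : Continuous fun r => expFactor α r s :=
    continuous_iff_continuousAt.2 fun r => (hasDerivAt_expFactor hα r s).continuousAt
  refine Integrable.mono' ((integrableOn_exp_mul_Iic (half_pos hc) s).const_mul
    (M * K * C * ((1 + 2 / c) * Real.exp (c * |s|))))
    ((hα.mul hcont).mul hω).aestronglyMeasurable ?_
  filter_upwards [ae_restrict_mem measurableSet_Iic] with r hr
  have habs : |r| ≤ 2 * |s| - r := by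
    have := le_abs_self s
    have := abs_nonneg s
    rw [Set.mem_Iic] at hr
    rw [abs_le]; constructor <;> linarith
  have hlin : 1 + |r| ≤ (1 + 2 / c) * Real.exp (c / 2 * |r|) := by
    have h1 : 1 ≤ Real.exp (c / 2 * |r|) := Real.one_le_exp (by positivity)
    have h2 : c / 2 * |r| ≤ Real.exp (c / 2 * |r|) := by
      linarith [Real.add_one_le_exp (c / 2 * |r|)]
    have h3 : |r| = 2 / c * (c / 2 * |r|) := by field_simp
    calc 1 + |r| = 1 + 2 / c * (c / 2 * |r|) := by rw [← h3]
      _ ≤ Real.exp (c / 2 * |r|) + 2 / c * Real.exp (c / 2 * |r|) := by gcongr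
      _ = _ := by ring
  have hexp : Real.exp (c * r) * Real.exp (c / 2 * |r|) ≤
      Real.exp (c * |s|) * Real.exp (c / 2 * r) := by
    rw [← Real.exp_add, ← Real.exp_add, Real.exp_le_exp]
    linarith [mul_le_mul_of_nonneg_left habs (half_pos hc).le]
  have hpos := expFactor_pos α r s
  rw [Real.norm_eq_abs, abs_mul, abs_mul, abs_of_pos hpos]
  calc |α r| * expFactor α r s * |ω r|
      ≤ M * (K * Real.exp (c * r)) * (C * ((1 + 2 / c) * Real.exp (c / 2 * |r|))) := by
        gcongr
        · exact hM' r
        · exact hle r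
        · exact (hgrow r).trans (by gcongr)
    _ = M * K * C * (1 + 2 / c) * (Real.exp (c * r) * Real.exp (c / 2 * |r|)) := by ring
    _ ≤ M * K * C * (1 + 2 / c) * (Real.exp (c * |s|) * Real.exp (c / 2 * r)) := by gcongr
    _ = _ := by ring

theorem integrableOn_mul_expFactor {τ : ℝ} (hτ : 0 < τ) {α : ℝ → ℝ} (hα : Continuous α)
    (hper : Function.Periodic α τ) (hmean : 0 < ∫ u in (0 : ℝ)..τ, α u) (s : ℝ) :
    IntegrableOn (fun r => α r * expFactor α r s) (Set.Iic s) := by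
  simpa using integrableOn_mul_expFactor_mul hτ hα hper hmean (continuous_const (y := (1 : ℝ)))
    (C := 1) (fun r => by simp) s

/-- The weight `α(r) e(r,s)` has total mass one on `(-∞, s]`. -/
theorem integral_Iic_mul_expFactor {τ : ℝ} (hτ : 0 < τ) {α : ℝ → ℝ} (hα : Continuous α)
    (hper : Function.Periodic α τ) (hmean : 0 < ∫ u in (0 : ℝ)..τ, α u) (s : ℝ) :
    ∫ r in Set.Iic s, α r * expFactor α r s = 1 := by
  rw [integral_Iic_of_hasDerivAt_of_tendsto' (fun r _ => hasDerivAt_expFactor hα r s)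
    (integrableOn_mul_expFactor hτ hα hper hmean s) (tendsto_expFactor_atBot hτ hα hper hmean s)]
  simp [expFactor]

/-- for continuous `τ`-periodic `α` with positive mean and a
continuous path `ω` of at most linear growth,
`S(s + τ, ω) = S(s, θ_τ ω)` where `(θ_τ ω)(u) = ω(u + τ) - ω(τ)`. -/
theorem pathwiseRPS_periodic (τ : ℝ) (hτ : 0 < τ) (α : ℝ → ℝ)
    (hα : Continuous α) (hper : ∀ t : ℝ, α (t + τ) = α t)
    (hmean : 0 < ∫ u in (0:ℝ)..τ, α u)
    (ω : ℝ → ℝ) (hω : Continuous ω) (C : ℝ) (hC : 0 ≤ C)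
    (hgrow : ∀ r : ℝ, |ω r| ≤ C * (1 + |r|)) :
    ∀ s : ℝ, pathwiseRPS α (s + τ) ω = pathwiseRPS α s (fun u => ω (u + τ) - ω τ) := by
  intro s
  have hshift : ∫ r in Set.Iic (s + τ), α r * expFactor α r (s + τ) * ω r =
      ∫ r in Set.Iic s, α r * expFactor α r s * ω (r + τ) := by
    have h := (measurePreserving_add_right volume τ).setIntegral_preimage_emb
      (measurableEmbedding_addRight τ) (fun r => α r * expFactor α r (s + τ) * ω r)
      (Set.Iic (s + τ))
    simpa [hper, expFactor_add_period hper] using h.symm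
  have hgrow' : ∀ r, |ω (r + τ)| ≤ C * (1 + τ) * (1 + |r|) := fun r => by
    calc |ω (r + τ)| ≤ C * (1 + |r + τ|) := hgrow _
      _ ≤ C * ((1 + τ) * (1 + |r|)) := by
        gcongr
        have := abs_add_le r τ
        rw [abs_of_pos hτ] at this
        nlinarith [abs_nonneg r]
      _ = _ := by ring
  have hshiftInt : IntegrableOn (fun r => α r * expFactor α r s * ω (r + τ)) (Set.Iic s) :=
    integrableOn_mul_expFactor_mul hτ hα hper hmean
      (hω.comp (continuous_add_const τ)) hgrow' s
  simp only [pathwiseRPS, mul_sub]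
  rw [hshift, integral_sub hshiftInt ((integrableOn_mul_expFactor hτ hα hper hmean s).mul_const _),
    integral_mul_const, integral_Iic_mul_expFactor hτ hα hper hmean]
  ring
end

section
/- Let τ > 0 and let α : ℝ → ℝ be continuous and τ-periodic with ∫_0^τ α(u) du > 0. Then for every t ∈ ℝ, the improper integral ∫_{−∞}^{t} exp(−2∫_{s}^{t} α(u) du) ds is finite. -/
open MeasureTheory

theorem Continuous.continuous_intervalIntegral_left {α : ℝ → ℝ} (hα : Continuous α) (t : ℝ) :
    Continuous fun s => ∫ u in s..t, α u := by
  simp_rw [fun s => intervalIntegral.integral_symm (μ := volume) (f := α) t s]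
  exact (intervalIntegral.continuous_primitive (fun a b => hα.intervalIntegrable a b) t).neg

/-- The primitive of a periodic function differs from a linear function, whose slope is the mean,
by a bounded function. -/
theorem exists_abs_intervalIntegral_sub_mean_mul_le {τ : ℝ} (hτ : 0 < τ) {α : ℝ → ℝ}
    (hα : Continuous α) (hper : Function.Periodic α τ) (t : ℝ) :
    ∃ C, ∀ s, |(∫ u in s..t, α u) - (∫ u in (0 : ℝ)..τ, α u) / τ * (t - s)| ≤ C := by
  have hint : ∀ a b, IntervalIntegrable α volume a b := fun a b => hα.intervalIntegrable a b
  have hD : Function.Periodic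
      (fun s => (∫ u in s..t, α u) - (∫ u in (0 : ℝ)..τ, α u) / τ * (t - s)) τ := by
    intro s
    have hsplit :=
      intervalIntegral.integral_add_adjacent_intervals (hint s (s + τ)) (hint (s + τ) t)
    have hshift := hper.intervalIntegral_add_eq s 0
    rw [zero_add] at hshift
    have hmul : (∫ u in (0 : ℝ)..τ, α u) / τ * τ = ∫ u in (0 : ℝ)..τ, α u :=
      div_mul_cancel₀ _ hτ.ne'
    dsimp only
    linarith
  have hcont : Continuous
      (fun s => (∫ u in s..t, α u) - (∫ u in (0 : ℝ)..τ, α u) / τ * (t - s)) := by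
    have hprim := hα.continuous_intervalIntegral_left t
    fun_prop
  obtain ⟨C, hC⟩ := (hD.isBounded_of_continuous hτ.ne' hcont).exists_norm_le
  exact ⟨C, fun s => hC _ ⟨s, rfl⟩⟩

/-- for a continuous `τ`-periodic `α` with `∫_0^τ α > 0`, the
improper integral `∫_{-∞}^t exp(-2 ∫_s^t α(u) du) ds` is finite, i.e. the
integrand is integrable on `(-∞, t]`. -/
theorem exp_decay_integrable (τ : ℝ) (hτ : 0 < τ) (α : ℝ → ℝ)
    (hα : Continuous α) (hper : ∀ t : ℝ, α (t + τ) = α t)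
    (hmean : 0 < ∫ u in (0:ℝ)..τ, α u) (t : ℝ) :
    IntegrableOn (fun s => Real.exp (-(2 * ∫ u in s..t, α u))) (Set.Iic t) := by
  obtain ⟨C, hC⟩ := exists_abs_intervalIntegral_sub_mean_mul_le hτ hα hper t
  have hc := div_pos hmean hτ
  set c := (∫ u in (0 : ℝ)..τ, α u) / τ
  have hprim := hα.continuous_intervalIntegral_left t
  have hdom : IntegrableOn (fun s => Real.exp (2 * C - 2 * c * t) * Real.exp (2 * c * s))
      (Set.Iic t) :=
    (integrableOn_exp_mul_Iic (by positivity) t).const_mul _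
  refine hdom.mono' (by fun_prop) (ae_of_all _ fun s => ?_)
  rw [Real.norm_eq_abs, Real.abs_exp, ← Real.exp_add, Real.exp_le_exp]
  linarith [(abs_le.mp (hC s)).1]
end
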